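/- arXiv:math/0010251 — 5 statements merged into one kernel-verified Lean document; each statement's English description precedes it below -/
import Mathlib

section
/- Let V be an irreducible n-dimensional complex representation of ℤ_p ∗ ℤ_q. Then the associated quiver representation V_Q of the full bipartite quiver Q (with p left vertices, q right vertices, and one arrow from each left vertex to each right vertex) is θ-stable for θ = (−1,...,−1; 1,...,1). -/
/-!
STATEMENT 3: If V is an irreducible n-dimensional complex representation of ℤ_p ∗ ℤ_q,
then the associated representation V_Q of the full bipartite quiver (eigenspaces S_i of a
at the left vertices, eigenspaces T_j of b at the right vertices, and the eigenspace
projections φ_{ij} : S_i → T_j as arrow maps) is θ-stable for θ = (−1,...,−1;1,...,1).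

The maps φ_{ij} are characterized by the property that for every x ∈ S_i one has
x = Σ_j φ_{ij}(x) in V.  θ-stability of V_Q says: θ(V_Q) = Σ_j dim T_j − Σ_i dim S_i = 0
and for every subrepresentation (U_i ⊆ S_i, W_j ⊆ T_j) other than 0 and V_Q we have
θ(U,W) = Σ_j dim W_j − Σ_i dim U_i > 0.
-/

/-- The free product ℤ_p ∗ ℤ_q of cyclic groups of orders p and q. -/
abbrev FreeProdCyclic (p q : ℕ) : Type :=
  Monoid.Coprod (Multiplicative (ZMod p)) (Multiplicative (ZMod q))

/-- The generator `a` of the factor ℤ_p. -/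
def genA (p q : ℕ) : FreeProdCyclic p q :=
  Monoid.Coprod.inl (Multiplicative.ofAdd (1 : ZMod p))

/-- The generator `b` of the factor ℤ_q. -/
def genB (p q : ℕ) : FreeProdCyclic p q :=
  Monoid.Coprod.inr (Multiplicative.ofAdd (1 : ZMod q))

/-- A representation is irreducible if it has no invariant subspaces other than `0` and
the whole space. -/
def IsIrreducibleRep {G V : Type} [Monoid G] [AddCommGroup V] [Module ℂ V]
    (ρ : Representation ℂ G V) : Prop :=
  ∀ U : Submodule ℂ V, (∀ g : G, ∀ x ∈ U, ρ g x ∈ U) → U = ⊥ ∨ U = ⊤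

open Module Module.End

theorem iSupIndep.finrank_iSup {K V ι : Type*} [Field K] [AddCommGroup V] [Module K V]
    [FiniteDimensional K V] [Fintype ι] {N : ι → Submodule K V} (hN : iSupIndep N) :
    finrank K (⨆ i, N i : Submodule K V) = ∑ i, finrank K (N i) := by
  classical
  rw [Submodule.iSup_eq_range_dfinsupp_lsum]
  exact (LinearMap.finrank_range_of_inj
    (f := DFinsupp.lsum ℕ (M := fun i => N i) fun i => (N i).subtype)
    hN.dfinsupp_lsum_injective).trans (finrank_directSum K fun i => N i)

theorem Submodule.eq_bot_of_iSup_map_eq_bot {K V ι : Type*} [Field K] [AddCommGroup V]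
    [Module K V] {E : ι → Submodule K V} {U : ∀ i, Submodule K (E i)}
    (h : ⨆ i, (U i).map (E i).subtype = ⊥) (i : ι) : U i = ⊥ := by
  exact Submodule.map_injective_of_injective (E i).injective_subtype
    (((iSup_eq_bot.mp h) i).trans (Submodule.map_bot _).symm)

section RootsOfUnity

variable {V : Type*} [AddCommGroup V] [Module ℂ V] {m : ℕ} {ω : ℂ} {f : End ℂ V}

theorem iSup_eigenspace_pow_eq_top [FiniteDimensional ℂ V] (hm : 0 < m)
    (hω : IsPrimitiveRoot ω m) (hf : f ^ m = 1) :
    ⨆ i : Fin m, eigenspace f (ω ^ (i : ℕ)) = ⊤ := by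
  have hss : f.IsSemisimple := by
    refine isSemisimple_of_squarefree_aeval_eq_zero (p := (Polynomial.X ^ m - 1 : Polynomial ℂ))
      (Polynomial.X_pow_sub_one_separable_iff.mpr ?_).squarefree ?_
    · exact_mod_cast hm.ne'
    · simp [hf]
  rw [eq_top_iff, ← hss.iSup_eigenspace_eq_top]
  refine iSup_le fun μ => ?_
  by_cases hμ : HasEigenvalue f μ
  · obtain ⟨v, hv⟩ := hμ.exists_hasEigenvector
    have hpow : μ ^ m = 1 := by
      have h := hv.pow_apply m
      rw [hf, one_apply] at h
      have h' : (μ ^ m - 1) • v = 0 := by rw [sub_smul, ← h, one_smul, sub_self]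
      exact sub_eq_zero.mp ((smul_eq_zero.mp h').resolve_right hv.2)
    have : NeZero m := ⟨hm.ne'⟩
    obtain ⟨i, hi, rfl⟩ := hω.eq_pow_of_pow_eq_one hpow
    exact le_iSup (fun i : Fin m => eigenspace f (ω ^ (i : ℕ))) ⟨i, hi⟩
  · rw [hasEigenvalue_iff, not_not] at hμ
    simp [hμ]

theorem iSupIndep_eigenspace_pow (hω : IsPrimitiveRoot ω m) :
    iSupIndep fun i : Fin m => eigenspace f (ω ^ (i : ℕ)) :=
  f.eigenspaces_iSupIndep.comp fun i j h => Fin.ext (hω.pow_inj i.2 j.2 h)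

theorem finrank_iSup_map_eigenspace_pow [FiniteDimensional ℂ V] (hω : IsPrimitiveRoot ω m)
    {E : Fin m → Submodule ℂ V} (hE : ∀ i, E i = eigenspace f (ω ^ (i : ℕ)))
    (U : ∀ i, Submodule ℂ (E i)) :
    finrank ℂ (⨆ i, (U i).map (E i).subtype : Submodule ℂ V) = ∑ i, finrank ℂ (U i) := by
  have hind : iSupIndep fun i => (U i).map (E i).subtype :=
    (iSupIndep_eigenspace_pow (f := f) hω).mono fun i =>
      (Submodule.map_subtype_le _ _).trans (hE i).le
  rw [hind.finrank_iSup]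
  exact Finset.sum_congr rfl fun i _ => Submodule.finrank_map_subtype_eq _ _

theorem sum_finrank_eigenspace_pow [FiniteDimensional ℂ V] (hm : 0 < m)
    (hω : IsPrimitiveRoot ω m) (hf : f ^ m = 1)
    {E : Fin m → Submodule ℂ V} (hE : ∀ i, E i = eigenspace f (ω ^ (i : ℕ))) :
    ∑ i, finrank ℂ (E i) = finrank ℂ V := by
  obtain rfl : E = fun i : Fin m => eigenspace f (ω ^ (i : ℕ)) := funext hE
  rw [← (iSupIndep_eigenspace_pow hω).finrank_iSup, iSup_eigenspace_pow_eq_top hm hω hf,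
    finrank_top]

theorem eq_top_of_iSup_map_eq_top [FiniteDimensional ℂ V] (hm : 0 < m)
    (hω : IsPrimitiveRoot ω m) (hf : f ^ m = 1)
    {E : Fin m → Submodule ℂ V} (hE : ∀ i, E i = eigenspace f (ω ^ (i : ℕ)))
    {U : ∀ i, Submodule ℂ (E i)} (h : ⨆ i, (U i).map (E i).subtype = ⊤) (i : Fin m) :
    U i = ⊤ := by
  have hsum : ∑ i, finrank ℂ (U i) = ∑ i, finrank ℂ (E i) := by
    rw [← finrank_iSup_map_eigenspace_pow hω hE, h, finrank_top,
      sum_finrank_eigenspace_pow hm hω hf hE]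
  exact Submodule.eq_top_of_finrank_eq
    ((Finset.sum_eq_sum_iff_of_le fun i _ => Submodule.finrank_le (U i)).mp hsum i
      (Finset.mem_univ i))

theorem apply_mem_iSup_map_eigenspace_pow
    {E : Fin m → Submodule ℂ V} (hE : ∀ i, E i = eigenspace f (ω ^ (i : ℕ)))
    (U : ∀ i, Submodule ℂ (E i)) {x : V} (hx : x ∈ ⨆ i, (U i).map (E i).subtype) :
    f x ∈ ⨆ i, (U i).map (E i).subtype := by
  suffices h : ⨆ i, (U i).map (E i).subtype ≤
      (⨆ i, (U i).map (E i).subtype : Submodule ℂ V).comap f from h hx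
  refine iSup_le fun i => ?_
  rintro _ ⟨y, hy, rfl⟩
  have hfy : f y = ω ^ (i : ℕ) • (y : V) := mem_eigenspace_iff.mp (hE i ▸ y.2)
  rw [Submodule.mem_comap, Submodule.subtype_apply, hfy]
  exact Submodule.smul_mem _ _ (le_iSup (fun i => (U i).map (E i).subtype) i ⟨y, hy, rfl⟩)

end RootsOfUnity

theorem ofAdd_one_pow_val {m : ℕ} (hm : 0 < m) (x : Multiplicative (ZMod m)) :
    Multiplicative.ofAdd (1 : ZMod m) ^ x.toAdd.val = x := by
  have : NeZero m := ⟨hm.ne'⟩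
  rw [← ofAdd_nsmul, nsmul_one, ZMod.natCast_zmod_val, ofAdd_toAdd]

theorem ofAdd_one_pow_card (m : ℕ) : Multiplicative.ofAdd (1 : ZMod m) ^ m = 1 := by
  rw [← ofAdd_nsmul, nsmul_one, ZMod.natCast_self, ofAdd_zero]

theorem genA_pow (p q : ℕ) : genA p q ^ p = 1 := by
  rw [genA, ← map_pow, ofAdd_one_pow_card, map_one]

theorem genB_pow (p q : ℕ) : genB p q ^ q = 1 := by
  rw [genB, ← map_pow, ofAdd_one_pow_card, map_one]

theorem FreeProdCyclic.invariant_of_generators {p q : ℕ} (hp : 0 < p) (hq : 0 < q) {V : Type*}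
    [AddCommGroup V] [Module ℂ V] (ρ : Representation ℂ (FreeProdCyclic p q) V)
    {N : Submodule ℂ V} (hA : ∀ x ∈ N, ρ (genA p q) x ∈ N) (hB : ∀ x ∈ N, ρ (genB p q) x ∈ N)
    (g : FreeProdCyclic p q) : ∀ x ∈ N, ρ g x ∈ N := by
  have hpow : ∀ h : FreeProdCyclic p q, (∀ x ∈ N, ρ h x ∈ N) → ∀ k : ℕ, ∀ x ∈ N,
      ρ (h ^ k) x ∈ N := by
    intro h hh k
    induction k with
    | zero => simp
    | succ k ih =>
      intro x hx
      rw [pow_succ, map_mul]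
      exact ih _ (hh x hx)
  induction g using Monoid.Coprod.induction_on with
  | inl y =>
    rw [← ofAdd_one_pow_val hp y, map_pow]
    exact hpow _ hA _
  | inr y =>
    rw [← ofAdd_one_pow_val hq y, map_pow]
    exact hpow _ hB _
  | mul g h hg hh =>
    intro x hx
    rw [map_mul]
    exact hg _ (hh x hx)

theorem stmt3 (p q : ℕ) (hp : 0 < p) (hq : 0 < q) (ζ ξ : ℂ)
    (hζ : IsPrimitiveRoot ζ p) (hξ : IsPrimitiveRoot ξ q) (n : ℕ)
    (ρ : Representation ℂ (FreeProdCyclic p q) (Fin n → ℂ))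
    (hirr : IsIrreducibleRep ρ)
    (S : Fin p → Submodule ℂ (Fin n → ℂ))
    (hS : ∀ i : Fin p, S i = Module.End.eigenspace (ρ (genA p q)) (ζ ^ (i : ℕ)))
    (T : Fin q → Submodule ℂ (Fin n → ℂ))
    (hT : ∀ j : Fin q, T j = Module.End.eigenspace (ρ (genB p q)) (ξ ^ (j : ℕ)))
    (φ : ∀ (i : Fin p) (j : Fin q), S i →ₗ[ℂ] T j)
    (hφ : ∀ (i : Fin p) (x : S i), (x : Fin n → ℂ) = ∑ j, (φ i j x : Fin n → ℂ)) :
    -- θ(V_Q) = 0 :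
    ((∑ j, (Module.finrank ℂ (T j) : ℤ)) - ∑ i, (Module.finrank ℂ (S i) : ℤ)) = 0 ∧
    -- every subrepresentation other than 0 and V_Q has θ > 0 :
    ∀ (U : ∀ i : Fin p, Submodule ℂ (S i)) (W : ∀ j : Fin q, Submodule ℂ (T j)),
      (∀ (i : Fin p) (j : Fin q), ∀ x ∈ U i, φ i j x ∈ W j) →
      ((∀ i, U i = ⊥) ∧ (∀ j, W j = ⊥)) ∨ ((∀ i, U i = ⊤) ∧ (∀ j, W j = ⊤)) ∨
        0 < (∑ j, (Module.finrank ℂ (W j) : ℤ)) - ∑ i, (Module.finrank ℂ (U i) : ℤ) := by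
  have hA : ρ (genA p q) ^ p = 1 := by rw [← map_pow, genA_pow, map_one]
  have hB : ρ (genB p q) ^ q = 1 := by rw [← map_pow, genB_pow, map_one]
  refine ⟨?_, fun U W hUW => ?_⟩
  · rw [← Nat.cast_sum, ← Nat.cast_sum, sum_finrank_eigenspace_pow hq hξ hB hT,
      sum_finrank_eigenspace_pow hp hζ hA hS, sub_self]
  have hle : ⨆ i, (U i).map (S i).subtype ≤ ⨆ j, (W j).map (T j).subtype := by
    refine iSup_le fun i => ?_
    rintro _ ⟨x, hx, rfl⟩
    rw [Submodule.subtype_apply, hφ i x]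
    exact Submodule.sum_mem _ fun j _ =>
      le_iSup (fun j => (W j).map (T j).subtype) j ⟨φ i j x, hUW i j x hx, rfl⟩
  by_cases heq : ⨆ i, (U i).map (S i).subtype = ⨆ j, (W j).map (T j).subtype
  · have hinv := FreeProdCyclic.invariant_of_generators hp hq ρ
      (fun x hx => apply_mem_iSup_map_eigenspace_pow hS U hx)
      (fun x hx => heq ▸ apply_mem_iSup_map_eigenspace_pow hT W (heq ▸ hx))
    rcases hirr _ hinv with h | h
    · exact Or.inl ⟨Submodule.eq_bot_of_iSup_map_eq_bot h,
        Submodule.eq_bot_of_iSup_map_eq_bot (heq ▸ h)⟩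
    · exact Or.inr (Or.inl ⟨eq_top_of_iSup_map_eq_top hp hζ hA hS h,
        eq_top_of_iSup_map_eq_top hq hξ hB hT (heq ▸ h)⟩)
  · have hlt := Submodule.finrank_lt_finrank_of_lt (lt_of_le_of_ne hle heq)
    rw [finrank_iSup_map_eigenspace_pow hζ hS, finrank_iSup_map_eigenspace_pow hξ hT] at hlt
    refine Or.inr (Or.inr (sub_pos.mpr ?_))
    exact_mod_cast hlt
end

section
/- Let Q be the full bipartite quiver with p left vertices, q right vertices, and one arrow from each left vertex to each right vertex, let θ = (−1,...,−1;1,...,1), and let α = (a_1,...,a_p; b_1,...,b_q) with Σ_i a_i = n = Σ_j b_j. Let W be an α-dimensional representation of Q such that the n × n block matrix m(W) = (φ_{ij}(W))_{j,i} (whose (j,i)-block is the map assigned to the arrow from the i-th left vertex to the j-th right vertex) is invertible. Then W is isomorphic to the quiver representation V_Q associated to some n-dimensional representation V of ℤ_p ∗ ℤ_q, and if W is θ-stable then V is irreducible. -/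
/-- The block matrix `m(W)` of a representation of the full bipartite quiver, as a linear
map `⊕_i ℂ^{a_i} → ⊕_j ℂ^{b_j}`. -/
noncomputable def blockMap {p q : ℕ} {a : Fin p → ℕ} {b : Fin q → ℕ}
    (φ : ∀ (i : Fin p) (j : Fin q), (Fin (a i) → ℂ) →ₗ[ℂ] (Fin (b j) → ℂ)) :
    (∀ i : Fin p, Fin (a i) → ℂ) →ₗ[ℂ] (∀ j : Fin q, Fin (b j) → ℂ) :=
  LinearMap.pi fun j => ∑ i, (φ i j).comp (LinearMap.proj i)

/-- θ-stability (θ = (−1,...,−1;1,...,1)) of a representation of the full bipartite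
quiver: θ(W) = Σ b_j − Σ a_i = 0 and every subrepresentation other than 0 and W has
θ-value Σ_j dim W_j − Σ_i dim U_i > 0. -/
def BipThetaStable {p q : ℕ} {a : Fin p → ℕ} {b : Fin q → ℕ}
    (φ : ∀ (i : Fin p) (j : Fin q), (Fin (a i) → ℂ) →ₗ[ℂ] (Fin (b j) → ℂ)) : Prop :=
  ((∑ j, (b j : ℤ)) - ∑ i, (a i : ℤ)) = 0 ∧
  ∀ (U : ∀ i : Fin p, Submodule ℂ (Fin (a i) → ℂ))
    (W : ∀ j : Fin q, Submodule ℂ (Fin (b j) → ℂ)),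
    (∀ (i : Fin p) (j : Fin q), ∀ x ∈ U i, φ i j x ∈ W j) →
    ((∀ i, U i = ⊥) ∧ (∀ j, W j = ⊥)) ∨ ((∀ i, U i = ⊤) ∧ (∀ j, W j = ⊤)) ∨
      0 < (∑ j, (Module.finrank ℂ (W j) : ℤ)) - ∑ i, (Module.finrank ℂ (U i) : ℤ)

section CyclicDiagonal

variable {V : Type} [AddCommGroup V] [Module ℂ V] {p : ℕ} {a : Fin p → ℕ}

/-- The diagonal operator acting on the `i`-th block by `ω ^ i`. -/
noncomputable def blockScale (a : Fin p → ℕ) :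
    ℂ →* Module.End ℂ (∀ i : Fin p, Fin (a i) → ℂ) where
  toFun ω := LinearMap.pi fun i => ω ^ (i : ℕ) • LinearMap.proj i
  map_one' := by ext; simp
  map_mul' ω η := by
    refine LinearMap.ext fun x => funext fun i => ?_
    simp [mul_pow, mul_smul]

theorem blockScale_apply (ω : ℂ) (x : ∀ i : Fin p, Fin (a i) → ℂ) (i : Fin p) :
    blockScale a ω x i = ω ^ (i : ℕ) • x i := rfl

/-- The representation of `ℤ_p` on `V` whose generator acts by `ζ ^ i` on the `i`-th summand of a
decomposition of `V`. -/
noncomputable def cyclicRep [NeZero p] (e : (∀ i : Fin p, Fin (a i) → ℂ) ≃ₗ[ℂ] V) {ζ : ℂ}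
    (hζ : ζ ^ p = 1) : Representation ℂ (Multiplicative (ZMod p)) V :=
  (e.conjRingEquiv.toMonoidHom.comp (blockScale a)).comp (AddChar.zmodChar p hζ).toMonoidHom

theorem cyclicRep_one_apply [NeZero p] (e : (∀ i : Fin p, Fin (a i) → ℂ) ≃ₗ[ℂ] V) {ζ : ℂ}
    (hζ : ζ ^ p = 1) (x : V) :
    cyclicRep e hζ (Multiplicative.ofAdd 1) x = e (blockScale a ζ (e.symm x)) := by
  have h : (AddChar.zmodChar p hζ) (1 : ZMod p) = ζ := by
    simpa using AddChar.zmodChar_apply' hζ 1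
  change e (blockScale a (AddChar.zmodChar p hζ (1 : ZMod p)) (e.symm x)) = _
  rw [h]

/-- The `i`-th block is the `ζ ^ i`-eigenspace of the block scaling operator. -/
theorem exists_equiv_eigenspace (e : (∀ i : Fin p, Fin (a i) → ℂ) ≃ₗ[ℂ] V) {ζ : ℂ}
    (hζ : IsPrimitiveRoot ζ p) (T : Module.End ℂ V)
    (hT : ∀ x, T x = e (blockScale a ζ (e.symm x))) (i : Fin p) :
    ∃ u : (Fin (a i) → ℂ) ≃ₗ[ℂ] Module.End.eigenspace T (ζ ^ (i : ℕ)),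
      ∀ x, (u x : V) = e (Pi.single i x) := by
  have hmem (x : Fin (a i) → ℂ) : e (Pi.single i x) ∈ Module.End.eigenspace T (ζ ^ (i : ℕ)) := by
    rw [Module.End.mem_eigenspace_iff, hT, ← map_smul, e.symm_apply_apply]
    congr 1
    funext j
    rw [blockScale_apply]
    rcases eq_or_ne j i with rfl | hj
    · simp
    · simp [hj]
  let f : (Fin (a i) → ℂ) →ₗ[ℂ] Module.End.eigenspace T (ζ ^ (i : ℕ)) :=
    (e.toLinearMap.comp (LinearMap.single ℂ _ i)).codRestrict _ hmem
  have hf (x) : (f x : V) = e (Pi.single i x) := rfl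
  refine ⟨LinearEquiv.ofBijective f ⟨fun x y h => ?_, fun y => ⟨e.symm y i, ?_⟩⟩, hf⟩
  · exact Pi.single_injective i (e.injective (congrArg Subtype.val h))
  · refine Subtype.ext ?_
    rw [hf, ← e.apply_symm_apply (y : V)]
    congr 1
    funext j
    rcases eq_or_ne j i with rfl | hj
    · simp
    · rw [Pi.single_eq_of_ne hj]
      have h := Module.End.mem_eigenspace_iff.1 y.2
      rw [hT, ← e.symm.injective.eq_iff, e.symm_apply_apply, map_smul] at h
      have h' := congrFun h j
      rw [blockScale_apply, Pi.smul_apply, ← sub_eq_zero, ← sub_smul, smul_eq_zero] at h'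
      rcases h' with h' | h'
      · exact absurd (Fin.ext (hζ.pow_inj j.2 i.2 (sub_eq_zero.1 h'))) hj
      · simp [h']

/-- A subspace invariant under the block scaling operator contains the block components of its
elements. -/
theorem single_mem_of_invariant (e : (∀ i : Fin p, Fin (a i) → ℂ) ≃ₗ[ℂ] V) {ζ : ℂ}
    (hζ : IsPrimitiveRoot ζ p) (T : Module.End ℂ V)
    (hT : ∀ x, T x = e (blockScale a ζ (e.symm x))) {U : Submodule ℂ V}
    (hU : ∀ x ∈ U, T x ∈ U) {x : V} (hx : x ∈ U) (i : Fin p) :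
    e (Pi.single i (e.symm x i)) ∈ U := by
  have hp : (p : ℂ) ≠ 0 := Nat.cast_ne_zero.2 (Fin.pos i).ne'
  have hζ0 : ζ ≠ 0 := hζ.ne_zero (Fin.pos i).ne'
  have hpow (k : ℕ) :
      (T ^ k) x ∈ U ∧ ∀ j, e.symm ((T ^ k) x) j = (ζ ^ (j : ℕ)) ^ k • e.symm x j := by
    induction k with
    | zero => simpa using hx
    | succ k ih =>
      rw [pow_succ', Module.End.mul_apply]
      refine ⟨hU _ ih.1, fun j => ?_⟩
      rw [hT, e.symm_apply_apply, blockScale_apply, ih.2, smul_smul, pow_succ']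
  have key : e (Pi.single i (e.symm x i)) =
      (p : ℂ)⁻¹ • ∑ k ∈ Finset.range p, ((ζ ^ (i : ℕ))⁻¹) ^ k • (T ^ k) x := by
    rw [← e.symm.injective.eq_iff, e.symm_apply_apply, map_smul, map_sum]
    funext j
    simp only [map_smul, Pi.smul_apply, Finset.sum_apply, (hpow _).2, smul_smul, ← mul_pow,
      ← Finset.sum_smul]
    rcases eq_or_ne j i with rfl | hj
    · simp [inv_mul_cancel₀ (pow_ne_zero (j : ℕ) hζ0), hp]
    · have h1 : (ζ ^ (i : ℕ))⁻¹ * ζ ^ (j : ℕ) ≠ 1 := fun h => hj <| Fin.ext <|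
        hζ.pow_inj j.2 i.2 ((inv_mul_eq_one₀ (pow_ne_zero _ hζ0)).1 h).symm
      have h2 : ((ζ ^ (i : ℕ))⁻¹ * ζ ^ (j : ℕ)) ^ p = 1 := by
        rw [mul_pow, inv_pow, pow_right_comm, pow_right_comm ζ (j : ℕ), hζ.pow_eq_one]
        simp
      rw [geom_sum_eq h1, h2, Pi.single_eq_of_ne hj]
      simp
  rw [key]
  exact U.smul_mem _ (U.sum_mem fun k _ => U.smul_mem _ (hpow k).1)

/-- The intersection of a subspace `U` with the `i`-th block. -/
noncomputable def blockComap (e : (∀ i : Fin p, Fin (a i) → ℂ) ≃ₗ[ℂ] V) (U : Submodule ℂ V)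
    (i : Fin p) : Submodule ℂ (Fin (a i) → ℂ) :=
  U.comap (e.toLinearMap.comp (LinearMap.single ℂ (fun i => Fin (a i) → ℂ) i))

theorem mem_blockComap {e : (∀ i : Fin p, Fin (a i) → ℂ) ≃ₗ[ℂ] V} {U : Submodule ℂ V} {i : Fin p}
    {x : Fin (a i) → ℂ} : x ∈ blockComap e U i ↔ e (Pi.single i x) ∈ U := Iff.rfl

theorem map_pi_blockComap {e : (∀ i : Fin p, Fin (a i) → ℂ) ≃ₗ[ℂ] V} {U : Submodule ℂ V}
    (hU : ∀ x ∈ U, ∀ i, e (Pi.single i (e.symm x i)) ∈ U) :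
    (Submodule.pi Set.univ (blockComap e U)).map e.toLinearMap = U := by
  ext x
  constructor
  · rintro ⟨y, hy, rfl⟩
    rw [← Finset.univ_sum_single y, map_sum]
    exact U.sum_mem fun i _ => mem_blockComap.1 (hy i trivial)
  · exact fun hx => ⟨e.symm x, fun i _ => mem_blockComap.2 (hU x hx i), e.apply_symm_apply x⟩

theorem finrank_eq_sum_blockComap {e : (∀ i : Fin p, Fin (a i) → ℂ) ≃ₗ[ℂ] V} {U : Submodule ℂ V}
    (hU : ∀ x ∈ U, ∀ i, e (Pi.single i (e.symm x i)) ∈ U) :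
    Module.finrank ℂ U = ∑ i, Module.finrank ℂ (blockComap e U i) := by
  let f : (∀ i, blockComap e U i) ≃ₗ[ℂ] Submodule.pi Set.univ (blockComap e U) :=
    { toFun := fun x => ⟨fun i => x i, fun i _ => (x i).2⟩
      invFun := fun x i => ⟨x.1 i, x.2 i trivial⟩
      map_add' := fun _ _ => rfl
      map_smul' := fun _ _ => rfl
      left_inv := fun _ => rfl
      right_inv := fun _ => rfl }
  rw [← Module.finrank_pi_fintype ℂ, f.finrank_eq]
  conv_lhs => rw [← map_pi_blockComap hU]
  exact LinearEquiv.finrank_map_eq e _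

end CyclicDiagonal

theorem blockMap_single {p q : ℕ} {a : Fin p → ℕ} {b : Fin q → ℕ}
    (φ : ∀ (i : Fin p) (j : Fin q), (Fin (a i) → ℂ) →ₗ[ℂ] (Fin (b j) → ℂ)) (i : Fin p)
    (x : Fin (a i) → ℂ) : blockMap φ (Pi.single i x) = fun j => φ i j x := by
  funext j
  simp only [blockMap, LinearMap.pi_apply, LinearMap.sum_apply, LinearMap.comp_apply,
    LinearMap.proj_apply]
  rw [Finset.sum_eq_single i (fun k _ hk => by simp [hk]) (by simp), Pi.single_eq_same]

theorem stmt4 (p q : ℕ) (hp : 0 < p) (hq : 0 < q) (ζ ξ : ℂ)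
    (hζ : IsPrimitiveRoot ζ p) (hξ : IsPrimitiveRoot ξ q)
    (n : ℕ) (a : Fin p → ℕ) (b : Fin q → ℕ)
    (ha : ∑ i, a i = n) (hb : ∑ j, b j = n)
    (φ : ∀ (i : Fin p) (j : Fin q), (Fin (a i) → ℂ) →ₗ[ℂ] (Fin (b j) → ℂ))
    (hinv : Function.Bijective (blockMap φ)) :
    ∃ (ρ : Representation ℂ (FreeProdCyclic p q) (Fin n → ℂ))
      (u : ∀ i : Fin p,
        (Fin (a i) → ℂ) ≃ₗ[ℂ] Module.End.eigenspace (ρ (genA p q)) (ζ ^ (i : ℕ)))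
      (v : ∀ j : Fin q,
        (Fin (b j) → ℂ) ≃ₗ[ℂ] Module.End.eigenspace (ρ (genB p q)) (ξ ^ (j : ℕ))),
      (∀ (i : Fin p) (x : Fin (a i) → ℂ),
        ((u i x : Fin n → ℂ)) = ∑ j, ((v j (φ i j x) : Fin n → ℂ))) ∧
      (BipThetaStable φ → IsIrreducibleRep ρ) := by
  have : NeZero p := ⟨hp.ne'⟩
  have : NeZero q := ⟨hq.ne'⟩
  let E : (∀ j : Fin q, Fin (b j) → ℂ) ≃ₗ[ℂ] (Fin n → ℂ) :=
    LinearEquiv.ofFinrankEq _ _ (by simp [Module.finrank_pi_fintype, hb])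
  let F : (∀ i : Fin p, Fin (a i) → ℂ) ≃ₗ[ℂ] (Fin n → ℂ) :=
    (LinearEquiv.ofBijective (blockMap φ) hinv).trans E
  have hF (i : Fin p) (x : Fin (a i) → ℂ) : F (Pi.single i x) = E fun j => φ i j x :=
    congrArg E (blockMap_single φ i x)
  let ρ : Representation ℂ (FreeProdCyclic p q) (Fin n → ℂ) :=
    Monoid.Coprod.lift (cyclicRep F hζ.pow_eq_one) (cyclicRep E hξ.pow_eq_one)
  have hA (x) : ρ (genA p q) x = F (blockScale a ζ (F.symm x)) := by
    simp only [ρ, genA, Monoid.Coprod.lift_apply_inl, cyclicRep_one_apply]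
  have hB (x) : ρ (genB p q) x = E (blockScale b ξ (E.symm x)) := by
    simp only [ρ, genB, Monoid.Coprod.lift_apply_inr, cyclicRep_one_apply]
  choose u hu using exists_equiv_eigenspace F hζ _ hA
  choose v hv using exists_equiv_eigenspace E hξ _ hB
  refine ⟨ρ, u, v, fun i x => ?_, fun hst U hU => ?_⟩
  · simp only [hu, hv, hF]
    rw [← map_sum, Finset.univ_sum_single]
  · have hUF (x) (hx : x ∈ U) := single_mem_of_invariant F hζ _ hA (hU _) hx
    have hUE (x) (hx : x ∈ U) := single_mem_of_invariant E hξ _ hB (hU _) hx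
    have hsub (i : Fin p) (j : Fin q) (x) (hx : x ∈ blockComap F U i) :
        φ i j x ∈ blockComap E U j := by
      rw [mem_blockComap, hF] at hx
      simpa [mem_blockComap] using hUE _ hx j
    rcases hst.2 _ _ hsub with h | h | h
    · left
      rw [← map_pi_blockComap hUF, funext h.1]
      simp [Submodule.pi_univ_bot]
    · right
      rw [← map_pi_blockComap hUF, funext h.1]
      simp
    · rw [← Nat.cast_sum, ← Nat.cast_sum, ← finrank_eq_sum_blockComap hUF,
        ← finrank_eq_sum_blockComap hUE, sub_self] at h
      exact absurd h (lt_irrefl _)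
end

section
/- Let Q be the full bipartite quiver with p left vertices, q right vertices, and one arrow from each left vertex to each right vertex, and let θ = (−1,...,−1; 1,...,1). Let W be a representation of Q of dimension vector α = (a_1,...,a_p; b_1,...,b_q) with Σ_i a_i = n = Σ_j b_j such that the n × n block matrix m(W) of all the arrow maps is invertible. Then every subrepresentation U of W of dimension vector (c_1,...,c_p; d_1,...,d_q) satisfies θ(U) = Σ_j d_j − Σ_i c_i ≥ 0; in particular W is θ-semistable. -/
theorem blockMap_apply {p q : ℕ} {a : Fin p → ℕ} {b : Fin q → ℕ}
    (φ : ∀ (i : Fin p) (j : Fin q), (Fin (a i) → ℂ) →ₗ[ℂ] (Fin (b j) → ℂ))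
    (x : ∀ i : Fin p, Fin (a i) → ℂ) (j : Fin q) :
    blockMap φ x j = ∑ i, φ i j (x i) := by
  simp [blockMap]

/-- A subrepresentation of a representation with injective block matrix has total dimension on
the left at most its total dimension on the right. -/
theorem sum_finrank_le_of_blockMap_injective {p q : ℕ} {a : Fin p → ℕ} {b : Fin q → ℕ}
    (φ : ∀ (i : Fin p) (j : Fin q), (Fin (a i) → ℂ) →ₗ[ℂ] (Fin (b j) → ℂ))
    (hφ : Function.Injective (blockMap φ))
    (U : ∀ i : Fin p, Submodule ℂ (Fin (a i) → ℂ))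
    (W : ∀ j : Fin q, Submodule ℂ (Fin (b j) → ℂ))
    (hsub : ∀ (i : Fin p) (j : Fin q), ∀ x ∈ U i, φ i j x ∈ W j) :
    ∑ i, Module.finrank ℂ (U i) ≤ ∑ j, Module.finrank ℂ (W j) := by
  let incl : (∀ i, U i) →ₗ[ℂ] (∀ i : Fin p, Fin (a i) → ℂ) :=
    LinearMap.pi fun i => (U i).subtype.comp (LinearMap.proj i)
  have hmem (j : Fin q) (x : ∀ i, U i) :
      ((LinearMap.proj j).comp ((blockMap φ).comp incl)) x ∈ W j := by
    change blockMap φ (incl x) j ∈ W j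
    rw [blockMap_apply]
    exact Submodule.sum_mem _ fun i _ => hsub i j _ (x i).2
  let restricted : (∀ i, U i) →ₗ[ℂ] (∀ j, W j) :=
    LinearMap.pi fun j => LinearMap.codRestrict (W j) _ (hmem j)
  have hinj : Function.Injective restricted := by
    intro x y hxy
    have hincl : incl x = incl y :=
      hφ (funext fun j => congrArg Subtype.val (congrFun hxy j))
    exact funext fun i => Subtype.ext (congrFun hincl i)
  simpa only [Module.finrank_pi_fintype] using LinearMap.finrank_le_finrank_of_injective hinj

theorem stmt5 (p q n : ℕ) (a : Fin p → ℕ) (b : Fin q → ℕ)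
    (ha : ∑ i, a i = n) (hb : ∑ j, b j = n)
    (φ : ∀ (i : Fin p) (j : Fin q), (Fin (a i) → ℂ) →ₗ[ℂ] (Fin (b j) → ℂ))
    (hinv : Function.Bijective (blockMap φ))
    -- a subrepresentation U of W, with spaces U_i ⊆ ℂ^{a_i} and W_j ⊆ ℂ^{b_j}
    (U : ∀ i : Fin p, Submodule ℂ (Fin (a i) → ℂ))
    (W : ∀ j : Fin q, Submodule ℂ (Fin (b j) → ℂ))
    (hsub : ∀ (i : Fin p) (j : Fin q), ∀ x ∈ U i, φ i j x ∈ W j)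
    (c : Fin p → ℕ) (d : Fin q → ℕ)
    (hc : ∀ i, c i = Module.finrank ℂ (U i)) (hd : ∀ j, d j = Module.finrank ℂ (W j)) :
    0 ≤ (∑ j, (d j : ℤ)) - ∑ i, (c i : ℤ) := by
  have h := sum_finrank_le_of_blockMap_injective φ hinv.injective U W hsub
  simp only [← hc, ← hd] at h
  exact sub_nonneg.mpr (by exact_mod_cast h)
end

section
/- Let Q be the full bipartite quiver with p left vertices, q right vertices, and one arrow from each left vertex to each right vertex, and let θ = (−1,...,−1; 1,...,1). Let W be a representation of Q with invertible block matrix m(W), and let U be a subrepresentation of W of dimension vector (c_1,...,c_p; d_1,...,d_q) with θ(U) = 0, i.e. Σ_i c_i = Σ_j d_j. Then the restriction of m(W) to U gives a linear isomorphism from U_L = ⊕_i U_i (the left vertex spaces of U) onto U_R = ⊕_j U_j (the right vertex spaces of U); in particular the block matrix m(U) of the subrepresentation U is invertible. -/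
/-- The product of submodules, as a submodule of the product, is the product of the
corresponding modules. -/
def Submodule.piUnivEquiv {R ι : Type*} [Semiring R] {M : ι → Type*}
    [∀ i, AddCommMonoid (M i)] [∀ i, Module R (M i)] (S : ∀ i, Submodule R (M i)) :
    Submodule.pi Set.univ S ≃ₗ[R] ∀ i, S i where
  toFun x i := ⟨x.1 i, x.2 i (Set.mem_univ i)⟩
  invFun y := ⟨fun i => y i, fun i _ => (y i).2⟩
  map_add' _ _ := rfl
  map_smul' _ _ := rfl
  left_inv _ := rfl
  right_inv _ := rfl

theorem Submodule.finrank_pi_univ {K ι : Type*} [Field K] [Fintype ι] {M : ι → Type*}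
    [∀ i, AddCommGroup (M i)] [∀ i, Module K (M i)] [∀ i, FiniteDimensional K (M i)]
    (S : ∀ i, Submodule K (M i)) :
    Module.finrank K (Submodule.pi Set.univ S) = ∑ i, Module.finrank K (S i) := by
  rw [(Submodule.piUnivEquiv S).finrank_eq, Module.finrank_pi_fintype]

theorem stmt6 (p q : ℕ) (a : Fin p → ℕ) (b : Fin q → ℕ)
    (φ : ∀ (i : Fin p) (j : Fin q), (Fin (a i) → ℂ) →ₗ[ℂ] (Fin (b j) → ℂ))
    (hinv : Function.Bijective (blockMap φ))
    -- a subrepresentation U of W, with spaces U_i ⊆ ℂ^{a_i} and W_j ⊆ ℂ^{b_j}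
    (U : ∀ i : Fin p, Submodule ℂ (Fin (a i) → ℂ))
    (W : ∀ j : Fin q, Submodule ℂ (Fin (b j) → ℂ))
    (hsub : ∀ (i : Fin p) (j : Fin q), ∀ x ∈ U i, φ i j x ∈ W j)
    (c : Fin p → ℕ) (d : Fin q → ℕ)
    (hc : ∀ i, c i = Module.finrank ℂ (U i)) (hd : ∀ j, d j = Module.finrank ℂ (W j))
    (htheta : ∑ i, c i = ∑ j, d j) :
    -- m(W) maps U_L = ⊕_i U_i into U_R = ⊕_j W_j, and the restricted map (which is the
    -- block matrix m(U) of the subrepresentation) is a linear isomorphism onto U_R :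
    ∃ h : ∀ x ∈ Submodule.pi (Set.univ : Set (Fin p)) U,
        blockMap φ x ∈ Submodule.pi (Set.univ : Set (Fin q)) W,
      Function.Bijective ((blockMap φ).restrict h) := by
  have h : ∀ x ∈ Submodule.pi (Set.univ : Set (Fin p)) U,
      blockMap φ x ∈ Submodule.pi (Set.univ : Set (Fin q)) W := by
    intro x hx j _
    simp only [blockMap, LinearMap.pi_apply, LinearMap.sum_apply, LinearMap.comp_apply,
      LinearMap.proj_apply]
    exact Submodule.sum_mem _ fun i _ => hsub i j _ (hx i (Set.mem_univ i))
  have hinj : Function.Injective ((blockMap φ).restrict h) := fun x y hxy =>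
    Subtype.ext (hinv.injective (congrArg Subtype.val hxy))
  have hdim : Module.finrank ℂ (Submodule.pi Set.univ U) =
      Module.finrank ℂ (Submodule.pi Set.univ W) := by
    simpa only [Submodule.finrank_pi_univ, hc, hd] using htheta
  exact ⟨h, hinj, (LinearMap.injective_iff_surjective_of_finrank_eq_finrank hdim).1 hinj⟩
end

section
/- Let K_n be the Kronecker quiver with two vertices and n arrows from the first vertex to the second, let 1 ≤ r ≤ n, α = (1, r), and θ = (−r, 1). Identify a representation V ∈ rep_α K_n with the r × n complex matrix whose i-th column is the linear map ℂ → ℂ^r assigned to the i-th arrow. Then V is θ-stable if and only if this r × n matrix has rank r. -/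
/-!
STATEMENT 11: Let K_n be the Kronecker quiver (two vertices, n arrows from the first to
the second), 1 ≤ r ≤ n, α = (1,r), θ = (−r,1).  Identify V ∈ rep_α K_n with the r×n
matrix M whose t-th column is the linear map ℂ → ℂ^r assigned to the t-th arrow (so the
t-th arrow sends x : Fin 1 → ℂ to the vector s ↦ x 0 * M s t).  Then V is θ-stable iff M
has rank r.

A subrepresentation is a pair of subspaces U ⊆ ℂ^1, W ⊆ ℂ^r with (arrow t)(U) ⊆ W for all
t; θ-stability means θ(V) = −r·1 + 1·r = 0 and θ(U,W) = −r·dim U + dim W > 0 for every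
subrepresentation (U,W) other than 0 and V.
-/

theorem stmt11 (n r : ℕ) (hr : 1 ≤ r) (hrn : r ≤ n) (M : Matrix (Fin r) (Fin n) ℂ) :
    ((-(r : ℤ)) * 1 + 1 * (r : ℤ) = 0 ∧
      ∀ (U : Submodule ℂ (Fin 1 → ℂ)) (W : Submodule ℂ (Fin r → ℂ)),
        (∀ (t : Fin n) (x : Fin 1 → ℂ), x ∈ U → (fun s => x 0 * M s t) ∈ W) →
        (U = ⊥ ∧ W = ⊥) ∨ (U = ⊤ ∧ W = ⊤) ∨
          0 < (-(r : ℤ)) * (Module.finrank ℂ U : ℤ) + (Module.finrank ℂ W : ℤ)) ↔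
      M.rank = r := by
  have hU : ∀ U : Submodule ℂ (Fin 1 → ℂ), U = ⊥ ∨ U = ⊤ := by
    have : IsSimpleModule ℂ (Fin 1 → ℂ) :=
      isSimpleModule_iff_finrank_eq_one.mpr (by simp)
    exact fun U => eq_bot_or_eq_top U
  rw [Matrix.rank_eq_finrank_span_cols]
  constructor
  · rintro ⟨-, h⟩
    have hle : Module.finrank ℂ (Submodule.span ℂ (Set.range M.col)) ≤ r := by
      simpa using Submodule.finrank_le (Submodule.span ℂ (Set.range M.col))
    rcases h ⊤ (Submodule.span ℂ (Set.range M.col)) (fun t x _ =>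
      Submodule.smul_mem _ (x 0) (Submodule.subset_span ⟨t, rfl⟩)) with h | h | h
    · exact absurd h.1 top_ne_bot
    · rw [h.2]
      simp
    · rw [finrank_top, Module.finrank_fin_fun] at h
      omega
  · intro h
    have hspan : Submodule.span ℂ (Set.range M.col) = ⊤ :=
      Submodule.eq_top_of_finrank_eq (by simpa using h)
    refine ⟨by ring, fun U W hUW => ?_⟩
    rcases hU U with rfl | rfl
    · by_cases hW : W = ⊥
      · exact Or.inl ⟨rfl, hW⟩
      · have hpos : 0 < Module.finrank ℂ W :=
          Nat.pos_of_ne_zero (mt Submodule.finrank_eq_zero.mp hW)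
        refine Or.inr (Or.inr ?_)
        rw [finrank_bot]
        omega
    · refine Or.inr (Or.inl ⟨rfl, top_le_iff.mp ?_⟩)
      rw [← hspan, Submodule.span_le]
      rintro _ ⟨t, rfl⟩
      have hmem := hUW t 1 trivial
      simp only [Pi.one_apply, one_mul] at hmem
      exact hmem
end
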